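/- There is a short exact sequence 0 → Z^2(N_0, D̄)/(B^2(C,D) ∩ C^{2,0}) → H^2(C,D) → ker(ρ_2)/B^2_1 → 0, where B^2_1 = π_1(B^2(C,D)), and ρ_2: A^2 → H^3(N_0, D̄) is the obstruction map of the bigraded complex. -/

import Mathlib

open DirectSum

variable {R M : Type} [CommRing R] [AddCommGroup M] [Module R M]

/-- Projection `π_q` of a bigraded module onto the part of second degree `≥ q`,
along the bigrading. -/
noncomputable def bproj (𝒞 : ℤ × ℤ → Submodule R M) [DirectSum.Decomposition 𝒞] (q : ℤ) :
    M →ₗ[R] M :=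
  (DirectSum.coeLinearMap 𝒞).comp <|
    (DFinsupp.filterLinearMap R (fun pq : ℤ × ℤ => 𝒞 pq) (fun pq => q ≤ pq.2)).comp
      (DirectSum.decomposeLinearEquiv 𝒞).toLinearMap

/-- The bihomogeneous component of bidegree `(p, q)` of an element. -/
noncomputable def bcomp (𝒞 : ℤ × ℤ → Submodule R M) [DirectSum.Decomposition 𝒞] (p q : ℤ)
    (x : M) : M :=
  (DirectSum.decompose 𝒞 x (p, q) : M)

/-- The total-degree-`k` part `C^k = ⊕_{p+q=k} C^{p,q}`. -/
def bdeg (𝒞 : ℤ × ℤ → Submodule R M) (k : ℤ) : Submodule R M :=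
  ⨆ p : ℤ, 𝒞 (p, k - p)

/-- The part of second degree `q`, `⊕_p C^{p,q}`. -/
def brow (𝒞 : ℤ × ℤ → Submodule R M) (q : ℤ) : Submodule R M :=
  ⨆ p : ℤ, 𝒞 (p, q)

/-- The decreasing column filtration `F^p C = ⊕_{i ≥ p, j} C^{i,j}`. -/
def bfil (𝒞 : ℤ × ℤ → Submodule R M) (p : ℤ) : Submodule R M :=
  ⨆ (i : ℤ) (_ : p ≤ i) (j : ℤ), 𝒞 (i, j)

section BigradedComplex

variable {𝒞 : ℤ × ℤ → Submodule R M}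

theorem mem_bdeg {p q k : ℤ} {x : M} (hx : x ∈ 𝒞 (p, q)) (h : p + q = k) : x ∈ bdeg 𝒞 k := by
  obtain rfl : q = k - p := by omega
  exact Submodule.mem_iSup_of_mem (p := fun p => 𝒞 (p, k - p)) p hx

/-- In a first-quadrant bigrading, an element of total degree two has three components. -/
theorem exists_of_mem_bdeg_two (hfq : ∀ p q : ℤ, p < 0 ∨ q < 0 → 𝒞 (p, q) = ⊥)
    {x : M} (hx : x ∈ bdeg 𝒞 2) :
    ∃ a ∈ 𝒞 (2, 0), ∃ b ∈ 𝒞 (1, 1), ∃ c ∈ 𝒞 (0, 2), x = a + b + c := by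
  have hle : bdeg 𝒞 2 ≤ 𝒞 (2, 0) ⊔ 𝒞 (1, 1) ⊔ 𝒞 (0, 2) := by
    refine iSup_le fun p => ?_
    by_cases h : p < 0 ∨ 2 - p < 0
    · rw [hfq _ _ h]
      exact bot_le
    · obtain rfl | rfl | rfl : p = 0 ∨ p = 1 ∨ p = 2 := by omega
      · exact le_sup_right
      · exact le_sup_right.trans le_sup_left
      · exact le_sup_left.trans le_sup_left
  obtain ⟨y, hy, c, hc, rfl⟩ := Submodule.mem_sup.mp (hle hx)
  obtain ⟨a, ha, b, hb, rfl⟩ := Submodule.mem_sup.mp hy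
  exact ⟨a, ha, b, hb, c, hc, rfl⟩

theorem map_bdeg_le {D21 D10 D01 : M →ₗ[R] M}
    (h21 : ∀ p q : ℤ, (𝒞 (p, q)).map D21 ≤ 𝒞 (p + 2, q - 1))
    (h10 : ∀ p q : ℤ, (𝒞 (p, q)).map D10 ≤ 𝒞 (p + 1, q))
    (h01 : ∀ p q : ℤ, (𝒞 (p, q)).map D01 ≤ 𝒞 (p, q + 1)) (k : ℤ) :
    (bdeg 𝒞 k).map (D21 + D10 + D01) ≤ bdeg 𝒞 (k + 1) := by
  rw [bdeg, Submodule.map_iSup]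
  refine iSup_le fun p => ?_
  rintro _ ⟨x, hx, rfl⟩
  refine add_mem (add_mem ?_ ?_) ?_
  · exact mem_bdeg (h21 _ _ ⟨x, hx, rfl⟩) (by ring)
  · exact mem_bdeg (h10 _ _ ⟨x, hx, rfl⟩) (by ring)
  · exact mem_bdeg (h01 _ _ ⟨x, hx, rfl⟩) (by ring)

variable [DirectSum.Decomposition 𝒞]

theorem bproj_of_le {p q r : ℤ} {x : M} (hx : x ∈ 𝒞 (p, q)) (h : r ≤ q) :
    bproj 𝒞 r x = x := by
  simp only [bproj, LinearMap.comp_apply, LinearEquiv.coe_coe, decomposeLinearEquiv_apply,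
    DFinsupp.filterLinearMap_apply]
  rw [decompose_of_mem 𝒞 hx]
  exact (congrArg (DirectSum.coeLinearMap 𝒞) (DFinsupp.filter_single_pos
    (β := fun pq => 𝒞 pq) (p := fun pq : ℤ × ℤ => r ≤ pq.2) (p, q) ⟨x, hx⟩ h)).trans
      (DirectSum.coeLinearMap_of 𝒞 _ _)

theorem bproj_of_lt {p q r : ℤ} {x : M} (hx : x ∈ 𝒞 (p, q)) (h : q < r) :
    bproj 𝒞 r x = 0 := by
  simp only [bproj, LinearMap.comp_apply, LinearEquiv.coe_coe, decomposeLinearEquiv_apply,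
    DFinsupp.filterLinearMap_apply]
  rw [decompose_of_mem 𝒞 hx]
  exact (congrArg (DirectSum.coeLinearMap 𝒞) (DFinsupp.filter_single_neg
    (β := fun pq => 𝒞 pq) (p := fun pq : ℤ × ℤ => r ≤ pq.2) (p, q) ⟨x, hx⟩ (not_le.mpr h))).trans
      (map_zero _)

theorem bcomp_add (p q : ℤ) (x y : M) :
    bcomp 𝒞 p q (x + y) = bcomp 𝒞 p q x + bcomp 𝒞 p q y := by
  simp [bcomp]

theorem bcomp_of_mem {p q : ℤ} {x : M} (hx : x ∈ 𝒞 (p, q)) : bcomp 𝒞 p q x = x :=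
  decompose_of_mem_same 𝒞 hx

theorem bcomp_of_mem_ne {p q p' q' : ℤ} {x : M} (hx : x ∈ 𝒞 (p', q'))
    (h : (p', q') ≠ (p, q)) : bcomp 𝒞 p q x = 0 :=
  decompose_of_mem_ne 𝒞 hx h

/-- A cochain of bidegree `(2, 0)` is closed iff it is closed for `D10` and for `D01`. -/
theorem apply_eq_zero_iff_of_mem_row_zero
    (hfq : ∀ p q : ℤ, p < 0 ∨ q < 0 → 𝒞 (p, q) = ⊥) {D21 D10 D01 : M →ₗ[R] M}
    (h21 : ∀ p q : ℤ, (𝒞 (p, q)).map D21 ≤ 𝒞 (p + 2, q - 1))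
    (h10 : ∀ p q : ℤ, (𝒞 (p, q)).map D10 ≤ 𝒞 (p + 1, q))
    (h01 : ∀ p q : ℤ, (𝒞 (p, q)).map D01 ≤ 𝒞 (p, q + 1))
    {p : ℤ} {x : M} (hx : x ∈ 𝒞 (p, 0)) :
    (D21 + D10 + D01) x = 0 ↔ D10 x = 0 ∧ D01 x = 0 := by
  have hx21 : D21 x = 0 := by
    have h := h21 _ _ ⟨x, hx, rfl⟩
    rwa [hfq _ _ (Or.inr (by norm_num)), Submodule.mem_bot] at h
  have hx10 : D10 x ∈ 𝒞 (p + 1, 0) := h10 _ _ ⟨x, hx, rfl⟩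
  have hx01 : D01 x ∈ 𝒞 (p, 0 + 1) := h01 _ _ ⟨x, hx, rfl⟩
  simp only [LinearMap.add_apply, hx21, zero_add]
  refine ⟨fun h => ?_, fun h => by rw [h.1, h.2, add_zero]⟩
  have h0 : D01 x = 0 := by
    have hπ := congrArg (bproj 𝒞 1) h
    rwa [map_add, bproj_of_lt hx10 (by norm_num), bproj_of_le hx01 (by norm_num), map_zero,
      zero_add] at hπ
  exact ⟨by rwa [h0, add_zero] at h, h0⟩

/-- If `D η` has no component of positive second degree, it is the obstruction cochain of `η`. -/
theorem apply_eq_obstruction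
    (hfq : ∀ p q : ℤ, p < 0 ∨ q < 0 → 𝒞 (p, q) = ⊥) {D21 D10 D01 : M →ₗ[R] M}
    (h21 : ∀ p q : ℤ, (𝒞 (p, q)).map D21 ≤ 𝒞 (p + 2, q - 1))
    (h10 : ∀ p q : ℤ, (𝒞 (p, q)).map D10 ≤ 𝒞 (p + 1, q))
    (h01 : ∀ p q : ℤ, (𝒞 (p, q)).map D01 ≤ 𝒞 (p, q + 1))
    {η : M} (hη : η ∈ bdeg 𝒞 2) (hπ : bproj 𝒞 1 ((D21 + D10 + D01) η) = 0) :
    (D21 + D10 + D01) η = D21 (bcomp 𝒞 1 1 η) + D10 (bcomp 𝒞 2 0 η) := by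
  obtain ⟨a, ha, b, hb, c, hc, rfl⟩ := exists_of_mem_bdeg_two hfq hη
  have hb' : bcomp 𝒞 1 1 (a + b + c) = b := by
    rw [bcomp_add, bcomp_add, bcomp_of_mem hb, bcomp_of_mem_ne ha (by simp),
      bcomp_of_mem_ne hc (by simp), zero_add, add_zero]
  have ha' : bcomp 𝒞 2 0 (a + b + c) = a := by
    rw [bcomp_add, bcomp_add, bcomp_of_mem ha, bcomp_of_mem_ne hb (by simp),
      bcomp_of_mem_ne hc (by simp), add_zero, add_zero]
  have hDa : D21 a = 0 := by
    have h := h21 _ _ ⟨a, ha, rfl⟩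
    rwa [hfq _ _ (Or.inr (by norm_num)), Submodule.mem_bot] at h
  rw [ha', hb']
  simp only [LinearMap.add_apply, map_add, hDa] at hπ ⊢
  rw [bproj_of_lt (h21 _ _ ⟨b, hb, rfl⟩) (by norm_num),
    bproj_of_le (h21 _ _ ⟨c, hc, rfl⟩) (by norm_num),
    bproj_of_lt (h10 _ _ ⟨a, ha, rfl⟩) (by norm_num),
    bproj_of_le (h10 _ _ ⟨b, hb, rfl⟩) (by norm_num),
    bproj_of_le (h10 _ _ ⟨c, hc, rfl⟩) (by norm_num),
    bproj_of_le (h01 _ _ ⟨a, ha, rfl⟩) (by norm_num),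
    bproj_of_le (h01 _ _ ⟨b, hb, rfl⟩) (by norm_num),
    bproj_of_le (h01 _ _ ⟨c, hc, rfl⟩) (by norm_num), map_zero] at hπ
  rw [← sub_eq_zero]
  refine Eq.trans ?_ hπ
  abel

theorem mem_of_bproj_one_eq_zero (hfq : ∀ p q : ℤ, p < 0 ∨ q < 0 → 𝒞 (p, q) = ⊥)
    {x : M} (hx : x ∈ bdeg 𝒞 2) (hπ : bproj 𝒞 1 x = 0) : x ∈ 𝒞 (2, 0) := by
  obtain ⟨a, ha, b, hb, c, hc, rfl⟩ := exists_of_mem_bdeg_two hfq hx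
  rw [map_add, map_add, bproj_of_lt ha (by norm_num), bproj_of_le hb le_rfl,
    bproj_of_le hc (by norm_num), zero_add] at hπ
  rwa [add_assoc, hπ, add_zero]

end BigradedComplex

theorem statement15
    (𝒞 : ℤ × ℤ → Submodule R M) [DirectSum.Decomposition 𝒞]
    (hfq : ∀ p q : ℤ, p < 0 ∨ q < 0 → 𝒞 (p, q) = ⊥)
    (D21 D10 D01 : M →ₗ[R] M)
    (h21 : ∀ p q : ℤ, (𝒞 (p, q)).map D21 ≤ 𝒞 (p + 2, q - 1))
    (h10 : ∀ p q : ℤ, (𝒞 (p, q)).map D10 ≤ 𝒞 (p + 1, q))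
    (h01 : ∀ p q : ℤ, (𝒞 (p, q)).map D01 ≤ 𝒞 (p, q + 1))
    (D : M →ₗ[R] M) (hDdef : D = D21 + D10 + D01) (hD : D ∘ₗ D = 0)
    (ZN2 : Submodule R M) (hZN2 : ZN2 = 𝒞 (2, 0) ⊓ LinearMap.ker D10 ⊓ LinearMap.ker D01)
    (B2 : Submodule R M) (hB2 : B2 = Submodule.map D (bdeg 𝒞 1))
    (Z2 : Submodule R M) (hZ2 : Z2 = bdeg 𝒞 2 ⊓ LinearMap.ker D)
    -- `B²₁ = π₁(B²(C,D))`
    (B21 : Submodule R M) (hB21 : B21 = Submodule.map (bproj 𝒞 1) B2)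
    -- `ker ρ₂`, described explicitly via lifts
    (Kρ : Submodule R M)
    (hKρ : (Kρ : Set M) = {ξ : M | ∃ η, η ∈ bdeg 𝒞 2 ∧ bproj 𝒞 1 η = ξ ∧
      bproj 𝒞 1 (D η) = 0 ∧
      D21 (bcomp 𝒞 1 1 η) + D10 (bcomp 𝒞 2 0 η) ∈
        Submodule.map D10 (𝒞 (2, 0) ⊓ LinearMap.ker D01)}) :
    -- there is a short exact sequence
    -- `0 → Z²(N₀,D̄)/(B²(C,D) ∩ C^{2,0}) → H²(C,D) → ker ρ₂ / B²₁ → 0`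
    ∃ (f : (↥ZN2 ⧸ Submodule.comap ZN2.subtype (B2 ⊓ 𝒞 (2, 0))) →ₗ[R]
        (↥Z2 ⧸ Submodule.comap Z2.subtype B2))
      (g : (↥Z2 ⧸ Submodule.comap Z2.subtype B2) →ₗ[R]
        (↥Kρ ⧸ Submodule.comap Kρ.subtype B21)),
      Function.Injective f ∧ Function.Surjective g ∧
      LinearMap.range f = LinearMap.ker g ∧
      (∀ (x : M) (hx : x ∈ ZN2) (hx' : x ∈ Z2),
        f (Submodule.Quotient.mk ⟨x, hx⟩) = Submodule.Quotient.mk ⟨x, hx'⟩) ∧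
      (∀ (x : M) (hx : x ∈ Z2) (hx' : bproj 𝒞 1 x ∈ Kρ),
        g (Submodule.Quotient.mk ⟨x, hx⟩) =
          Submodule.Quotient.mk ⟨bproj 𝒞 1 x, hx'⟩) := by
  have hZN2Z2 : ZN2 ≤ Z2 := by
    subst hZN2 hZ2 hDdef
    rintro x ⟨⟨hx, hx10⟩, hx01⟩
    exact ⟨mem_bdeg hx (by norm_num),
      (apply_eq_zero_iff_of_mem_row_zero hfq h21 h10 h01 hx).mpr ⟨hx10, hx01⟩⟩
  have hB2Z2 : B2 ≤ Z2 := by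
    subst hB2 hZ2 hDdef
    refine le_inf (map_bdeg_le h21 h10 h01 1) ?_
    rintro _ ⟨x, -, rfl⟩
    exact LinearMap.congr_fun hD x
  have mem_Kρ (x : M) : x ∈ Kρ ↔ _ := Set.ext_iff.mp hKρ x
  have hπ : ∀ x ∈ Z2, bproj 𝒞 1 x ∈ Kρ := by
    subst hZ2 hDdef
    rintro x ⟨hx, hDx⟩
    have hDx' : (D21 + D10 + D01) x = 0 := hDx
    have hπx : bproj 𝒞 1 ((D21 + D10 + D01) x) = 0 := by rw [hDx', map_zero]
    refine (mem_Kρ _).mpr ⟨x, hx, rfl, hπx, ?_⟩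
    rw [← apply_eq_obstruction hfq h21 h10 h01 hx hπx, hDx']
    exact zero_mem _
  have hπ_surj : ∀ ξ ∈ Kρ, ∃ x ∈ Z2, bproj 𝒞 1 x = ξ := by
    subst hZ2 hDdef
    intro ξ hξ
    obtain ⟨η, hη, rfl, hπη, c, ⟨hc, hc01⟩, hc10⟩ := (mem_Kρ ξ).mp hξ
    have hDη := apply_eq_obstruction hfq h21 h10 h01 hη hπη
    have hc21 : D21 c = 0 := by
      have h := h21 _ _ ⟨c, hc, rfl⟩
      rwa [hfq _ _ (Or.inr (by norm_num)), Submodule.mem_bot] at h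
    have hc01' : D01 c = 0 := hc01
    refine ⟨η - c, ⟨sub_mem hη (mem_bdeg hc (by norm_num)), ?_⟩, ?_⟩
    · refine LinearMap.mem_ker.mpr ?_
      rw [map_sub, hDη, ← hc10]
      simp [hc21, hc01']
    · rw [map_sub, bproj_of_lt hc (by norm_num), sub_zero]
  have hπ_ker : ∀ x ∈ Z2, bproj 𝒞 1 x = 0 → x ∈ ZN2 := by
    subst hZ2 hZN2 hDdef
    rintro x ⟨hx, hDx⟩ hπx
    have hx20 := mem_of_bproj_one_eq_zero hfq hx hπx
    have h := (apply_eq_zero_iff_of_mem_row_zero hfq h21 h10 h01 hx20).mp hDx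
    exact ⟨⟨hx20, h.1⟩, h.2⟩
  have hZN2_le : ZN2 ≤ 𝒞 (2, 0) := hZN2 ▸ inf_le_left.trans inf_le_left
  have hZN2_bproj : ∀ x ∈ ZN2, bproj 𝒞 1 x = 0 := fun x hx =>
    bproj_of_lt (hZN2_le hx) (by norm_num)
  have hf : Submodule.comap ZN2.subtype (B2 ⊓ 𝒞 (2, 0)) ≤
      (Submodule.comap Z2.subtype B2).comap (Submodule.inclusion hZN2Z2) :=
    fun x hx => (Submodule.mem_inf.mp hx).1
  have hg : Submodule.comap Z2.subtype B2 ≤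
      (Submodule.comap Kρ.subtype B21).comap ((bproj 𝒞 1).restrict hπ) := by
    subst hB21
    exact fun x hx => ⟨x, hx, rfl⟩
  refine ⟨Submodule.mapQ _ _ (Submodule.inclusion hZN2Z2) hf,
    Submodule.mapQ _ _ ((bproj 𝒞 1).restrict hπ) hg, ?_, ?_, ?_,
    fun _ _ _ => rfl, fun _ _ _ => rfl⟩
  · refine (injective_iff_map_eq_zero _).mpr fun y hy => ?_
    obtain ⟨x, rfl⟩ := Submodule.Quotient.mk_surjective _ y
    rw [Submodule.mapQ_apply, Submodule.Quotient.mk_eq_zero] at hy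
    exact (Submodule.Quotient.mk_eq_zero _).mpr ⟨hy, hZN2_le x.2⟩
  · intro y
    obtain ⟨⟨ξ, hξ⟩, rfl⟩ := Submodule.Quotient.mk_surjective _ y
    obtain ⟨x, hx, rfl⟩ := hπ_surj ξ hξ
    exact ⟨Submodule.Quotient.mk ⟨x, hx⟩, rfl⟩
  · refine le_antisymm ?_ ?_
    · rintro _ ⟨y, rfl⟩
      obtain ⟨x, rfl⟩ := Submodule.Quotient.mk_surjective _ y
      rw [LinearMap.mem_ker, Submodule.mapQ_apply, Submodule.mapQ_apply,
        Submodule.Quotient.mk_eq_zero]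
      change bproj 𝒞 1 (x : M) ∈ B21
      rw [hZN2_bproj x x.2]
      exact zero_mem _
    · intro y hy
      obtain ⟨⟨x, hx⟩, rfl⟩ := Submodule.Quotient.mk_surjective _ y
      rw [LinearMap.mem_ker, Submodule.mapQ_apply, Submodule.Quotient.mk_eq_zero] at hy
      change bproj 𝒞 1 x ∈ B21 at hy
      rw [hB21] at hy
      obtain ⟨b, hb, hbx⟩ := hy
      have hxb : x - b ∈ ZN2 :=
        hπ_ker _ (sub_mem hx (hB2Z2 hb)) (by rw [map_sub, hbx, sub_self])
      refine ⟨Submodule.Quotient.mk ⟨x - b, hxb⟩, ?_⟩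
      rw [Submodule.mapQ_apply, Submodule.Quotient.eq]
      change x - b - x ∈ B2
      rw [sub_sub_cancel_left]
      exact neg_mem hb
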